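/- Let W, Z ⊆ ℕ with W ≰_T Z, and let f be a 2-bounded coloring of [ℕ]^2 such that ℕ is a tail f-rainbow. If (σ, X) is an admissible Mathias condition (i.e., X ⊆ V(σ, f) and W ≰_T Z ⊕ X), then there exists an admissible Mathias condition (τ, Y) ≤_M (σ, X) with σ a proper subset of τ; that is, there exist a finite strictly increasing sequence τ and an infinite Y ⊆ ℕ with σ ⊊ τ, τ − σ ⊆ X, Y ⊆ X, max τ < min Y, Y ⊆ V(τ, f), and W ≰_T Z ⊕ Y. -/

import Mathlib

namespace RRT

/-- Partial functions on ℕ that are recursive in the oracle `O`.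
This mirrors `Nat.Partrec`, with an extra constructor for the oracle. -/
inductive RecursiveIn (O : ℕ →. ℕ) : (ℕ →. ℕ) → Prop
  | zero : RecursiveIn O (pure 0)
  | succ : RecursiveIn O Nat.succ
  | left : RecursiveIn O ↑fun n : ℕ => n.unpair.1
  | right : RecursiveIn O ↑fun n : ℕ => n.unpair.2
  | oracle : RecursiveIn O O
  | pair {f g} : RecursiveIn O f → RecursiveIn O g →
      RecursiveIn O fun n => Nat.pair <$> f n <*> g n
  | comp {f g} : RecursiveIn O f → RecursiveIn O g →
      RecursiveIn O fun n => g n >>= f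
  | prec {f g} : RecursiveIn O f → RecursiveIn O g →
      RecursiveIn O (Nat.unpaired fun a n =>
        n.rec (f a) fun y IH => do let i ← IH; g (Nat.pair a (Nat.pair y i)))
  | rfind {f} : RecursiveIn O f →
      RecursiveIn O fun a => Nat.rfind fun n => (fun m => m = 0) <$> f (Nat.pair a n)

/-- The characteristic function of a set of naturals. -/
noncomputable def chi (A : Set ℕ) : ℕ → ℕ := A.indicator fun _ => 1

/-- Turing reducibility `A ≤_T B` for sets of naturals: the characteristic function of `A`
is computable relative to an oracle for the characteristic function of `B`. -/
def TuringLE (A B : Set ℕ) : Prop := RecursiveIn (chi B) (chi A)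

/-- The recursive join `A ⊕ B = {2n : n ∈ A} ∪ {2n+1 : n ∈ B}`. -/
def join (A B : Set ℕ) : Set ℕ :=
  {n : ℕ | (∃ m ∈ A, n = 2 * m) ∨ (∃ m ∈ B, n = 2 * m + 1)}

/-- A total function `f : ℕ → ℕ` is computable relative to an oracle for `Z ⊆ ℕ`. -/
def FunRecIn (Z : Set ℕ) (f : ℕ → ℕ) : Prop := RecursiveIn (chi Z) f


/-- A coloring of `[ℕ]²` (identified with pairs `(x,y)`, `x < y`) is 2-bounded if
every color has at most 2 preimages. -/
def Bounded2Pairs (f : ℕ → ℕ → ℕ) : Prop :=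
  ∀ c : ℕ, {p : ℕ × ℕ | p.1 < p.2 ∧ f p.1 p.2 = c}.encard ≤ 2

/-- `X` is an `f`-rainbow: `f` is injective on `[X]²`. -/
def RainbowOn (f : ℕ → ℕ → ℕ) (X : Set ℕ) : Prop :=
  ∀ x₀ x₁ y₀ y₁ : ℕ, x₀ ∈ X → x₁ ∈ X → y₀ ∈ X → y₁ ∈ X →
    x₀ < x₁ → y₀ < y₁ → f x₀ x₁ = f y₀ y₁ → x₀ = y₀ ∧ x₁ = y₁

/-- `X` is a tail `f`-rainbow: pairs from `X` with distinct second coordinates get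
distinct colors. -/
def TailRainbowOn (f : ℕ → ℕ → ℕ) (X : Set ℕ) : Prop :=
  ∀ x₀ x₁ y₀ y₁ : ℕ, x₀ ∈ X → x₁ ∈ X → y₀ ∈ X → y₁ ∈ X →
    x₀ < x₁ → y₀ < y₁ → x₁ ≠ y₁ → f x₀ x₁ ≠ f y₀ y₁


/-- `V(σ,f) = {x > max σ : σ ∪ {x} is a rainbow for f}`, the viable numbers. -/
def Vset (f : ℕ → ℕ → ℕ) (σ : Finset ℕ) : Set ℕ :=
  {x : ℕ | (∀ a ∈ σ, a < x) ∧ RainbowOn f ↑(insert x σ)}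

end RRT
namespace RRT

/-- Initial segment of an oracle. -/
def seg (B : ℕ → Bool) (n : ℕ) : List Bool := (List.range n).map B

theorem seg_length (B : ℕ → Bool) (n : ℕ) : (seg B n).length = n := by simp [seg]

theorem seg_take (B : ℕ → Bool) (m n : ℕ) : (seg B n).take m = seg B (min m n) := by
  simp [seg, ← List.map_take, List.take_range]

theorem seg_getElem? (B : ℕ → Bool) (n i : ℕ) :
    (seg B n)[i]? = if i < n then some (B i) else none := by
  by_cases h : i < n <;> simp [seg, h]

/-- `P` is c.e. in the oracle `B`. -/
def CE {α : Type} [Primcodable α] (B : ℕ → Bool) (P : α → Prop) : Prop :=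
  ∃ D : List Bool → α → Prop, PrimrecRel D ∧ ∀ a, P a ↔ ∃ n, D (seg B n) a

section closure
variable {α β γ : Type} [Primcodable α] [Primcodable β] [Primcodable γ] {B : ℕ → Bool}

theorem CE.mono {P : α → Prop} (h : CE B P) :
    ∃ D : List Bool → α → Prop, PrimrecRel D ∧ (∀ a, P a ↔ ∃ n, D (seg B n) a) ∧
      ∀ a m n, m ≤ n → D (seg B m) a → D (seg B n) a := by
  obtain ⟨D, hD, hP⟩ := h
  refine ⟨fun ρ a => ∃ m < ρ.length + 1, D (ρ.take m) a, ?_, ?_, ?_⟩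
  · have h1 : PrimrecRel (fun (m : ℕ) (y : List Bool × α) => D (y.1.take m) y.2) :=
      hD.comp (Primrec.list_take.comp Primrec.fst (Primrec.fst.comp Primrec.snd))
        (Primrec.snd.comp Primrec.snd)
    have h2 := h1.exists_mem_list
    refine (h2.comp (f := fun p : List Bool × α => List.range (p.1.length + 1)) (g := fun p => p)
      (Primrec.list_range.comp (Primrec.succ.comp (Primrec.list_length.comp Primrec.fst)))
      Primrec.id).of_eq fun p => ?_
    simp only [List.mem_range]
  · intro a
    rw [hP]
    constructor
    · rintro ⟨n, hn⟩
      exact ⟨n, n, by simp [seg_length], by simpa [seg_take] using hn⟩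
    · rintro ⟨n, m, _, h⟩
      rw [seg_take] at h
      exact ⟨_, h⟩
  · rintro a m n hmn ⟨k, hk, h⟩
    rw [seg_length] at hk
    refine ⟨k, by rw [seg_length]; omega, ?_⟩
    rw [seg_take] at h ⊢
    rwa [min_eq_left (by omega)] at h ⊢

theorem CE.of_iff {P Q : α → Prop} (h : CE B P) (H : ∀ a, Q a ↔ P a) : CE B Q := by
  obtain ⟨D, hD, hP⟩ := h
  exact ⟨D, hD, fun a => (H a).trans (hP a)⟩

theorem CE.prim {P : α → Prop} (h : PrimrecPred P) : CE B P :=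
  ⟨fun _ a => P a, h.comp Primrec.snd, fun a => by simp⟩

theorem CE.comp {P : β → Prop} (h : CE B P) {f : α → β} (hf : Primrec f) :
    CE B (fun a => P (f a)) := by
  obtain ⟨D, hD, hP⟩ := h
  exact ⟨fun ρ a => D ρ (f a), hD.comp Primrec.fst (hf.comp Primrec.snd), fun a => hP _⟩

theorem CE.and {P Q : α → Prop} (h : CE B P) (h' : CE B Q) : CE B (fun a => P a ∧ Q a) := by
  obtain ⟨D, hD, hP, hm⟩ := h.mono
  obtain ⟨D', hD', hP', hm'⟩ := h'.mono
  refine ⟨fun ρ a => D ρ a ∧ D' ρ a, PrimrecPred.and hD hD', fun a => ?_⟩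
  show P a ∧ Q a ↔ ∃ n, D (seg B n) a ∧ D' (seg B n) a
  rw [hP, hP']
  constructor
  · rintro ⟨⟨n, hn⟩, ⟨m, hm1⟩⟩
    exact ⟨max n m, hm _ _ _ (le_max_left _ _) hn, hm' _ _ _ (le_max_right _ _) hm1⟩
  · rintro ⟨n, h1, h2⟩
    exact ⟨⟨n, h1⟩, ⟨n, h2⟩⟩

theorem CE.or {P Q : α → Prop} (h : CE B P) (h' : CE B Q) : CE B (fun a => P a ∨ Q a) := by
  obtain ⟨D, hD, hP⟩ := h
  obtain ⟨D', hD', hP'⟩ := h'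
  refine ⟨fun ρ a => D ρ a ∨ D' ρ a, PrimrecPred.or hD hD', fun a => ?_⟩
  show P a ∨ Q a ↔ ∃ n, D (seg B n) a ∨ D' (seg B n) a
  rw [hP, hP', exists_or]

theorem CE.ex {P : α × β → Prop} (h : CE B P) : CE B (fun a => ∃ b, P (a, b)) := by
  obtain ⟨D, hD, hP, hm⟩ := h.mono
  refine ⟨fun ρ a => ∃ b ∈ (List.range ρ.length).filterMap (fun i => (Encodable.decode i : Option β)),
    D ρ (a, b), ?_, fun a => ?_⟩
  · have h1 : PrimrecRel (fun (b : β) (y : List Bool × α) => D y.1 (y.2, b)) :=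
      hD.comp (Primrec.fst.comp Primrec.snd)
        (Primrec.pair (Primrec.snd.comp Primrec.snd) Primrec.fst)
    refine h1.exists_mem_list.comp (Primrec.listFilterMap
      (Primrec.list_range.comp (Primrec.list_length.comp Primrec.fst)) ?_) Primrec.id
    exact Primrec.decode.comp Primrec.snd
  · constructor
    · rintro ⟨b, hb⟩
      obtain ⟨n, hn⟩ := (hP _).1 hb
      refine ⟨max n (Encodable.encode b + 1), b, ?_, hm _ _ _ (le_max_left _ _) hn⟩
      rw [List.mem_filterMap]
      exact ⟨Encodable.encode b, by simp [seg_length], by simp⟩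
    · rintro ⟨n, b, _, hb⟩
      exact ⟨b, (hP _).2 ⟨n, hb⟩⟩

theorem CE.all {P : α × β → Prop} (h : CE B P) {f : α → List β} (hf : Primrec f) :
    CE B (fun a => ∀ b ∈ f a, P (a, b)) := by
  obtain ⟨D, hD, hP, hm⟩ := h.mono
  refine ⟨fun ρ a => ∀ b ∈ f a, D ρ (a, b), ?_, fun a => ?_⟩
  · have h1 : PrimrecRel (fun (b : β) (y : List Bool × α) => D y.1 (y.2, b)) :=
      hD.comp (Primrec.fst.comp Primrec.snd)
        (Primrec.pair (Primrec.snd.comp Primrec.snd) Primrec.fst)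
    exact h1.forall_mem_list.comp (hf.comp Primrec.snd) Primrec.id
  · constructor
    · intro H
      show ∃ n, ∀ b ∈ f a, D (seg B n) (a, b)
      change ∀ b ∈ f a, P (a, b) at H
      generalize f a = l at H ⊢
      induction l with
      | nil => exact ⟨0, by simp⟩
      | cons x l ih =>
        obtain ⟨n, hn⟩ := ih (fun b hb => H b (List.mem_cons_of_mem _ hb))
        obtain ⟨k, hk⟩ := (hP _).1 (H x List.mem_cons_self)
        refine ⟨max n k, fun b hb => ?_⟩
        rcases List.mem_cons.1 hb with rfl | hb
        · exact hm _ _ _ (le_max_right _ _) hk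
        · exact hm _ _ _ (le_max_left _ _) (hn b hb)
    · rintro ⟨n, hn⟩ b hb
      exact (hP _).2 ⟨n, hn b hb⟩

theorem CE.all_lt {P : α × ℕ → Prop} (h : CE B P) {f : α → ℕ} (hf : Primrec f) :
    CE B (fun a => ∀ b < f a, P (a, b)) :=
  (h.all (Primrec.list_range.comp hf)).of_iff fun a => by simp

theorem CE.oracle : CE B (fun a : ℕ × Bool => B a.1 = a.2) := by
  refine ⟨fun ρ a => ρ[a.1]? = some a.2, ?_, fun a => ?_⟩
  · exact Primrec.eq.comp (Primrec.list_getElem?.comp Primrec.fst (Primrec.fst.comp Primrec.snd))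
      (Primrec.option_some.comp (Primrec.snd.comp Primrec.snd))
  · constructor
    · intro h
      exact ⟨a.1 + 1, by simp [seg_getElem?, h]⟩
    · rintro ⟨n, h⟩
      rw [seg_getElem?] at h
      split_ifs at h
      simpa using h

/-- evaluation of `D` on a (partial) oracle given by a relation. -/
def EvR {α : Type} (D : List Bool → α → Prop) (Q : ℕ → Bool → Prop) (a : α) : Prop :=
  ∃ ρ : List Bool, D ρ a ∧ ∀ i < ρ.length, Q i (ρ.getD i false)

def Ev {α : Type} (D : List Bool → α → Prop) (B : ℕ → Bool) (a : α) : Prop := ∃ n, D (seg B n) a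

theorem CE.evR {D : List Bool → α → Prop} (hD : PrimrecRel D) {Q : β → ℕ → Bool → Prop}
    (hQ : CE B (fun x : β × ℕ × Bool => Q x.1 x.2.1 x.2.2)) :
    CE B (fun x : β × α => EvR D (Q x.1) x.2) := by
  unfold EvR
  refine CE.ex (P := fun y : (β × α) × List Bool => D y.2 y.1.2 ∧
    ∀ i < y.2.length, Q y.1.1 i (y.2.getD i false)) ?_
  refine CE.and (CE.prim ?_) ?_
  · exact hD.comp Primrec.snd (Primrec.snd.comp Primrec.fst)
  · refine CE.all_lt (P := fun z : ((β × α) × List Bool) × ℕ =>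
      Q z.1.1.1 z.2 (z.1.2.getD z.2 false)) ?_ (Primrec.list_length.comp Primrec.snd)
    exact hQ.comp (f := fun z : ((β × α) × List Bool) × ℕ => 
      (z.1.1.1, z.2, z.1.2.getD z.2 false))
      (Primrec.pair (Primrec.fst.comp (Primrec.fst.comp Primrec.fst))
        (Primrec.pair Primrec.snd ((Primrec.list_getD false).comp 
          (Primrec.snd.comp Primrec.fst) Primrec.snd)))

theorem seg_eq_iff (ρ : List Bool) (Y : ℕ → Bool) :
    (∀ i < ρ.length, Y i = ρ.getD i false) ↔ ρ = seg Y ρ.length := by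
  constructor
  · intro h
    refine List.ext_getElem (by simp [seg_length]) fun i h1 h2 => ?_
    have := h i h1
    simp [seg, this, h1]
  · intro h i hi
    rw [h]
    simp [seg, hi]

theorem evR_iff {α : Type} (D : List Bool → α → Prop) (Y : ℕ → Bool) (a : α) :
    EvR D (fun i b => Y i = b) a ↔ Ev D Y a := by
  unfold EvR Ev
  constructor
  · rintro ⟨ρ, h, h'⟩
    rw [seg_eq_iff] at h'
    exact ⟨_, h' ▸ h⟩
  · rintro ⟨n, h⟩
    exact ⟨_, h, (seg_eq_iff _ _).2 (by rw [seg_length])⟩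

theorem CE.trans {Y : ℕ → Bool} (hY : CE B (fun x : ℕ × Bool => Y x.1 = x.2)) {P : α → Prop}
    (h : CE Y P) : CE B P := by
  obtain ⟨D, hD, hP⟩ := h
  have := CE.evR (β := Unit) (Q := fun _ i b => Y i = b) hD (hY.comp Primrec.snd)
  refine (this.comp (f := fun a : α => ((), a)) 
    (Primrec.pair (Primrec.const _) Primrec.id)).of_iff fun a => ?_
  rw [evR_iff, hP]; rfl

/-- Compactness. -/
theorem koenig (V : List Bool → Prop) (h : ∀ B : ℕ → Bool, ∃ n, V (seg B n)) :
    ∃ n, ∀ B : ℕ → Bool, ∃ m < n, V (seg B m) := by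
  have hopen : ∀ n, IsOpen {B : ℕ → Bool | V (seg B n)} := by
    intro n
    have : Continuous (fun B : ℕ → Bool => (fun i : Fin n => B i)) := by fun_prop
    have h2 : {B : ℕ → Bool | V (seg B n)} =
      (fun B : ℕ → Bool => (fun i : Fin n => B i)) ⁻¹' {g | V (List.ofFn g)} := by
      ext B
      have : seg B n = List.ofFn (fun i : Fin n => B i) := by
        apply List.ext_getElem <;> simp [seg]
      simp [this]
    rw [h2]
    exact (isOpen_discrete _).preimage this
  obtain ⟨t, ht⟩ := isCompact_univ.elim_finite_subcover _ hopen
    (fun B _ => Set.mem_iUnion.2 (h B))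
  refine ⟨t.sup id + 1, fun B => ?_⟩
  obtain ⟨m, hm, hV⟩ := Set.mem_iUnion₂.1 (ht (Set.mem_univ B))
  exact ⟨m, Nat.lt_succ_of_le (Finset.le_sup (f := id) hm), hV⟩

theorem CE.compact {V : List Bool × α → Prop} (hV : CE B V) :
    CE B (fun a => ∀ Y : ℕ → Bool, ∃ n, V (seg Y n, a)) := by
  -- finite strings of length n
  let strs : ℕ → List (List Bool) := fun n => 
    Nat.rec [[]] (fun _ L => L.map (fun l => l ++ [false]) ++ L.map (fun l => l ++ [true])) n
  have hs : ∀ n l, l ∈ strs n ↔ ∃ Y, l = seg Y n := by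
    intro n
    induction n with
    | zero => intro l; simp [strs, seg]
    | succ n ih =>
      intro l
      have : l ∈ strs (n+1) ↔ ∃ b, ∃ l' ∈ strs n, l' ++ [b] = l := by
        simp [strs]
      rw [this]
      constructor
      · rintro ⟨b, l', h, rfl⟩
        obtain ⟨Y, rfl⟩ := (ih _).1 h
        refine ⟨fun i => if i < n then Y i else b, ?_⟩
        simp only [seg, List.range_succ, List.map_append, List.map_cons, List.map_nil, lt_irrefl, 
          if_false]
        congr 1
        apply List.map_congr_left
        intro i hi
        simp [List.mem_range.1 hi]
      · rintro ⟨Y, rfl⟩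
        exact ⟨Y n, seg Y n, (ih _).2 ⟨Y, rfl⟩, by simp [seg, List.range_succ]⟩
  have hp : Primrec strs := by
    refine Primrec.nat_rec₁ _ (f := fun _ (L : List (List Bool)) => 
      L.map (fun l => l ++ [false]) ++ L.map (fun l => l ++ [true])) ?_
    refine Primrec.list_append.comp (Primrec.list_map Primrec.snd ?_) 
      (Primrec.list_map Primrec.snd ?_)
    · exact Primrec.list_concat.comp Primrec.snd (Primrec.const _)
    · exact Primrec.list_concat.comp Primrec.snd (Primrec.const _)
  have h1 : CE B (fun x : ((α × ℕ) × List Bool) => ∃ m : ℕ, V (x.2.take m, x.1.1)) := by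
    refine CE.ex (P := fun x : ((α × ℕ) × List Bool) × ℕ => V (x.1.2.take x.2, x.1.1.1)) ?_
    exact hV.comp (f := fun x : ((α × ℕ) × List Bool) × ℕ => (x.1.2.take x.2, x.1.1.1))
      (Primrec.pair (Primrec.list_take.comp Primrec.snd (Primrec.snd.comp Primrec.fst))
        (Primrec.fst.comp (Primrec.fst.comp Primrec.fst)))
  refine (CE.ex (h1.all (f := fun x => strs x.2) (hp.comp Primrec.snd))).of_iff fun a => ?_
  constructor
  · intro h
    obtain ⟨n, hn⟩ := koenig (fun l => V (l, a)) h
    refine ⟨n, fun l hl => ?_⟩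
    obtain ⟨Y, rfl⟩ := (hs _ _).1 hl
    obtain ⟨m, hm, hV⟩ := hn Y
    exact ⟨m, by simpa [seg_take, min_eq_left hm.le] using hV⟩
  · rintro ⟨n, hn⟩ Y
    obtain ⟨m, hm⟩ := hn _ ((hs _ _).2 ⟨Y, rfl⟩)
    rw [seg_take] at hm
    exact ⟨_, hm⟩

end closure
end RRT
namespace RRT

open Classical in
/-- Boolean characteristic function. -/
noncomputable def bits (S : Set ℕ) : ℕ → Bool := fun i => decide (i ∈ S)

theorem ce_graph {S : Set ℕ} {g : ℕ →. ℕ} (h : RecursiveIn (chi S) g) :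
    CE (bits S) (fun x : ℕ × ℕ => x.2 ∈ g x.1) := by
  have tot : ∀ k : ℕ → ℕ, Primrec k → CE (bits S) (fun x : ℕ × ℕ => x.2 ∈ (k : ℕ →. ℕ) x.1) := by
    intro k hk
    refine (CE.prim (P := fun x : ℕ × ℕ => x.2 = k x.1)
      (Primrec.eq.comp Primrec.snd (hk.comp Primrec.fst))).of_iff fun x => ?_
    simp
  induction h with
  | zero => exact tot (fun _ => 0) (Primrec.const 0)
  | succ => exact tot _ Primrec.succ
  | left => exact tot _ (Primrec.fst.comp Primrec.unpair)
  | right => exact tot _ (Primrec.snd.comp Primrec.unpair)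
  | oracle =>
    have h1 : CE (bits S) (fun x : ℕ × ℕ => bits S x.1 = true ∧ x.2 = 1) := by
      refine CE.and ?_ (CE.prim (Primrec.eq.comp Primrec.snd (Primrec.const 1)))
      exact CE.oracle.comp (f := fun x : ℕ × ℕ => (x.1, true))
        (Primrec.pair Primrec.fst (Primrec.const _))
    have h2 : CE (bits S) (fun x : ℕ × ℕ => bits S x.1 = false ∧ x.2 = 0) := by
      refine CE.and ?_ (CE.prim (Primrec.eq.comp Primrec.snd (Primrec.const 0)))
      exact CE.oracle.comp (f := fun x : ℕ × ℕ => (x.1, false))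
        (Primrec.pair Primrec.fst (Primrec.const _))
    refine (h1.or h2).of_iff fun x => ?_
    by_cases hx : x.1 ∈ S <;> simp [bits, chi, hx]
  | @pair f g _ _ hf hg =>
    have h1 : CE (bits S) (fun x : (ℕ × ℕ) × (ℕ × ℕ) => 
        x.2.1 ∈ f x.1.1 ∧ x.2.2 ∈ g x.1.1 ∧ x.1.2 = Nat.pair x.2.1 x.2.2) := by
      refine CE.and ?_ (CE.and ?_ (CE.prim ?_))
      · exact hf.comp (f := fun x : (ℕ × ℕ) × (ℕ × ℕ) => (x.1.1, x.2.1))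
          (Primrec.pair (Primrec.fst.comp Primrec.fst) (Primrec.fst.comp Primrec.snd))
      · exact hg.comp (f := fun x : (ℕ × ℕ) × (ℕ × ℕ) => (x.1.1, x.2.2))
          (Primrec.pair (Primrec.fst.comp Primrec.fst) (Primrec.snd.comp Primrec.snd))
      · exact Primrec.eq.comp (Primrec.snd.comp Primrec.fst) (Primrec₂.natPair.comp
          (Primrec.fst.comp Primrec.snd) (Primrec.snd.comp Primrec.snd))
    refine h1.ex.of_iff fun x => ?_
    simp [Seq.seq]
    constructor
    · rintro ⟨a, ha, b, hb, h⟩; exact ⟨a, ha, b, hb, h.symm⟩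
    · rintro ⟨a, ha, b, hb, h⟩; exact ⟨a, ha, b, hb, h.symm⟩
  | @comp f g _ _ hf hg =>
    have h1 : CE (bits S) (fun x : (ℕ × ℕ) × ℕ => x.2 ∈ g x.1.1 ∧ x.1.2 ∈ f x.2) := by
      refine CE.and ?_ ?_
      · exact hg.comp (f := fun x : (ℕ × ℕ) × ℕ => (x.1.1, x.2))
          (Primrec.pair (Primrec.fst.comp Primrec.fst) Primrec.snd)
      · exact hf.comp (f := fun x : (ℕ × ℕ) × ℕ => (x.2, x.1.2))
          (Primrec.pair Primrec.snd (Primrec.snd.comp Primrec.fst))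
    refine h1.ex.of_iff fun x => ?_
    exact Part.mem_bind_iff
  | @prec f g _ _ hf hg =>
    have h1 : CE (bits S) (fun x : (ℕ × ℕ) × List ℕ =>
        x.2.getD 0 0 ∈ f x.1.1.unpair.1 ∧ x.2.getD x.1.1.unpair.2 0 = x.1.2 ∧
        ∀ i < x.1.1.unpair.2, x.2.getD (i+1) 0 ∈ 
          g (Nat.pair x.1.1.unpair.1 (Nat.pair i (x.2.getD i 0)))) := by
      have hu : Primrec (fun x : (ℕ × ℕ) × List ℕ => x.1.1.unpair) := 
        Primrec.unpair.comp (Primrec.fst.comp Primrec.fst)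
      refine CE.and ?_ (CE.and (CE.prim ?_) ?_)
      · exact hf.comp (f := fun x : (ℕ × ℕ) × List ℕ => (x.1.1.unpair.1, x.2.getD 0 0))
          (Primrec.pair (Primrec.fst.comp hu) 
            ((Primrec.list_getD 0).comp Primrec.snd (Primrec.const 0)))
      · exact Primrec.eq.comp ((Primrec.list_getD 0).comp Primrec.snd (Primrec.snd.comp hu)) 
          (Primrec.snd.comp Primrec.fst)
      · refine CE.all_lt (P := fun y : ((ℕ × ℕ) × List ℕ) × ℕ => y.1.2.getD (y.2+1) 0 ∈ 
          g (Nat.pair y.1.1.1.unpair.1 (Nat.pair y.2 (y.1.2.getD y.2 0)))) ?_ (Primrec.snd.comp hu)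
        exact hg.comp (f := fun y : ((ℕ × ℕ) × List ℕ) × ℕ => 
            (Nat.pair y.1.1.1.unpair.1 (Nat.pair y.2 (y.1.2.getD y.2 0)), y.1.2.getD (y.2+1) 0))
          (Primrec.pair (Primrec₂.natPair.comp (Primrec.fst.comp (hu.comp Primrec.fst))
            (Primrec₂.natPair.comp Primrec.snd ((Primrec.list_getD 0).comp 
              (Primrec.snd.comp Primrec.fst) Primrec.snd)))
            ((Primrec.list_getD 0).comp (Primrec.snd.comp Primrec.fst) 
              (Primrec.succ.comp Primrec.snd)))
    refine h1.ex.of_iff fun x => ?_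
    obtain ⟨x, v⟩ := x
    simp only [Nat.unpaired]
    generalize x.unpair.1 = a
    generalize x.unpair.2 = n
    induction n generalizing v with
    | zero =>
      simp only [List.getD_eq_getElem?_getD]
      constructor
      · intro h; exact ⟨[v], by simpa using h, by simp, by simp⟩
      · rintro ⟨l, h, h', -⟩; rw [← h']; exact h
    | succ n ih =>
      simp only [Part.bind_eq_bind, Part.mem_bind_iff]
      constructor
      · rintro ⟨w, hw, hv⟩
        obtain ⟨l, h0, hl, hs⟩ := (ih w).1 hw
        refine ⟨((List.range (n+1)).map (fun i => l.getD i 0)) ++ [v], ?_, ?_, ?_⟩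
        · simpa [List.getElem?_append] using h0
        · simp
        · intro i hi
          have e : ∀ j ≤ n, ((((List.range (n+1)).map (fun i => l.getD i 0)) ++ [v]).getD j 0)
            = l.getD j 0 := by
            intro j hj
            simp [List.getElem?_append, Nat.lt_succ_of_le hj]
          rw [e i (by omega)]
          rcases Nat.lt_succ_iff_lt_or_eq.1 hi with hi' | rfl
          · rw [e (i+1) (by omega)]; exact hs i hi'
          · rw [hl]
            simpa [List.getElem?_append] using hv
      · rintro ⟨l, h0, hl, hs⟩
        refine ⟨l.getD n 0, (ih _).2 ⟨l, h0, rfl, fun i hi => hs i (by omega)⟩, ?_⟩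
        have := hs n (by omega)
        change l.getD (n+1) 0 = v at hl
        rwa [hl] at this
  | @rfind f _ hf =>
    have h1 : CE (bits S) (fun x : ℕ × ℕ => 0 ∈ f (Nat.pair x.1 x.2)) :=
      hf.comp (f := fun x : ℕ × ℕ => (Nat.pair x.1 x.2, 0)) 
        (Primrec.pair Primrec₂.natPair (Primrec.const 0))
    have h2 : CE (bits S) (fun x : (ℕ × ℕ) × ℕ => ∃ k, k + 1 ∈ f (Nat.pair x.1.1 x.2)) := by
      refine CE.ex (P := fun y : ((ℕ × ℕ) × ℕ) × ℕ => y.2 + 1 ∈ f (Nat.pair y.1.1.1 y.1.2)) ?_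
      exact hf.comp (f := fun y : ((ℕ × ℕ) × ℕ) × ℕ => (Nat.pair y.1.1.1 y.1.2, y.2 + 1))
        (Primrec.pair (Primrec₂.natPair.comp (Primrec.fst.comp (Primrec.fst.comp Primrec.fst)) 
          (Primrec.snd.comp Primrec.fst)) (Primrec.succ.comp Primrec.snd))
    refine (h1.and (h2.all_lt Primrec.snd)).of_iff fun x => ?_
    refine Nat.mem_rfind.trans ?_
    refine and_congr ?_ (forall₂_congr fun m _ => ?_)
    · simp
    · simp
      constructor
      · rintro ⟨k, hk, h0⟩; exact ⟨k - 1, by rwa [Nat.sub_add_cancel (Nat.pos_of_ne_zero h0)]⟩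
      · rintro ⟨k, hk⟩; exact ⟨k+1, hk, by omega⟩

/-- graph of the characteristic function. -/
def Gr (W : Set ℕ) (x : ℕ × Bool) : Prop := bits W x.1 = x.2

theorem ce_of_turingLE {W S : Set ℕ} (h : TuringLE W S) : CE (bits S) (Gr W) := by
  have := (ce_graph h).comp (f := fun x : ℕ × Bool => (x.1, cond x.2 1 0))
    (Primrec.pair Primrec.fst (Primrec.cond Primrec.snd (Primrec.const 1) (Primrec.const 0)))
  refine this.of_iff fun x => ?_
  obtain ⟨x, b⟩ := x
  by_cases hx : x ∈ W <;> cases b <;> simp [Gr, bits, chi, hx]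

section
variable {O : ℕ →. ℕ}

theorem RecursiveIn.of_partrec {g : ℕ →. ℕ} (h : Nat.Partrec g) : RecursiveIn O g := by
  induction h with
  | zero => exact .zero
  | succ => exact .succ
  | left => exact .left
  | right => exact .right
  | pair _ _ h1 h2 => exact .pair h1 h2
  | comp _ _ h1 h2 => exact .comp h1 h2
  | prec _ _ h1 h2 => exact .prec h1 h2
  | rfind _ h => exact .rfind h

theorem RecursiveIn.of_eq {f g : ℕ →. ℕ} (hf : RecursiveIn O f) (H : ∀ n, f n = g n) :
    RecursiveIn O g := (funext H : f = g) ▸ hf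

theorem RecursiveIn.of_prim {g : ℕ → ℕ} (h : Primrec g) : RecursiveIn O (g : ℕ →. ℕ) :=
  .of_partrec (Nat.Partrec.of_primrec (Primrec.nat_iff.1 h))

theorem RecursiveIn.comp' {f g : ℕ → ℕ} (hf : RecursiveIn O (f : ℕ →. ℕ)) 
    (hg : RecursiveIn O (g : ℕ →. ℕ)) : RecursiveIn O ((fun n => f (g n) : ℕ → ℕ) : ℕ →. ℕ) := by
  have := hf.comp hg
  refine this.of_eq fun n => ?_
  exact Part.bind_some (g n) _

theorem RecursiveIn.pair' {f g : ℕ → ℕ} (hf : RecursiveIn O (f : ℕ →. ℕ)) 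
    (hg : RecursiveIn O (g : ℕ →. ℕ)) : 
    RecursiveIn O ((fun n => Nat.pair (f n) (g n) : ℕ → ℕ) : ℕ →. ℕ) := by
  have := hf.pair hg
  refine this.of_eq fun n => ?_
  simp [Seq.seq]

end

theorem seg_rec (S : Set ℕ) : RecursiveIn (chi S) 
    ((fun n => Encodable.encode (seg (bits S) n) : ℕ → ℕ) : ℕ →. ℕ) := by
  -- append a bit to an encoded list
  let app : ℕ → ℕ := fun x => Encodable.encode 
    ((((Encodable.decode x.unpair.1 : Option (List Bool))).getD []) ++ [decide (x.unpair.2 = 1)])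
  have happ : Primrec app := by
    refine Primrec.encode.comp (Primrec.list_concat.comp (Primrec.option_getD.comp 
      (Primrec.decode.comp (Primrec.fst.comp Primrec.unpair)) (Primrec.const _)) ?_)
    exact (Primrec.eq.comp (Primrec.snd.comp Primrec.unpair) (Primrec.const 1)).decide
  have hstep : RecursiveIn (chi S) ((fun x => app (Nat.pair x.unpair.2.unpair.2 
      (chi S x.unpair.2.unpair.1)) : ℕ → ℕ) : ℕ →. ℕ) := by
    refine (RecursiveIn.of_prim happ).comp' (RecursiveIn.pair' (RecursiveIn.of_prim ?_) 
      (RecursiveIn.comp' (RecursiveIn.oracle (O := chi S)) (RecursiveIn.of_prim ?_)))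
    · exact Primrec.snd.comp (Primrec.unpair.comp (Primrec.snd.comp Primrec.unpair))
    · exact Primrec.fst.comp (Primrec.unpair.comp (Primrec.snd.comp Primrec.unpair))
  have h := (RecursiveIn.prec (RecursiveIn.of_prim (O := chi S) 
    (Primrec.const (Encodable.encode ([] : List Bool)))) hstep).comp 
    (RecursiveIn.of_prim (g := fun n => Nat.pair 0 n) 
      (Primrec₂.natPair.comp (Primrec.const 0) Primrec.id))
  refine h.of_eq fun n => ?_
  symm
  simp only [PFun.coe_val, Part.bind_eq_bind, Part.bind_some, Nat.unpaired, Nat.unpair_pair]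
  induction n with
  | zero => simp [seg]
  | succ n ih =>
    simp only [← ih, Part.bind_some]
    congr 1
    have : decide (chi S n = 1) = bits S n := by
      by_cases hx : n ∈ S <;> simp [bits, chi, hx]
    simp only [app, Nat.unpair_pair, Encodable.encodek, Option.getD_some, this]
    simp [seg, List.range_succ]

theorem turingLE_of_ce {W S : Set ℕ} (h : CE (bits S) (Gr W)) : TuringLE W S := by
  obtain ⟨D, hD, hP⟩ := h
  classical
  -- test: input (code of segment, (p, b))
  let test : ℕ → ℕ := fun x => if D ((Encodable.decode x.unpair.1 : Option (List Bool)).getD []) 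
    (x.unpair.2.unpair.1, decide (x.unpair.2.unpair.2 = 1)) then 0 else 1
  have htest : Primrec test := by
    have hu2 := Primrec.unpair.comp (Primrec.snd.comp Primrec.unpair)
    refine Primrec.ite (hD.comp (Primrec.option_getD.comp 
      (Primrec.decode.comp (Primrec.fst.comp Primrec.unpair)) (Primrec.const _)) 
      (Primrec.pair (Primrec.fst.comp hu2) 
        (Primrec.eq.comp (Primrec.snd.comp hu2) (Primrec.const 1)).decide)) 
      (Primrec.const 0) (Primrec.const 1)
  -- body on pair p m where m = pair n b
  have hbody : RecursiveIn (chi S) ((fun x => test (Nat.pair 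
      (Encodable.encode (seg (bits S) x.unpair.2.unpair.1)) 
      (Nat.pair x.unpair.1 x.unpair.2.unpair.2)) : ℕ → ℕ) : ℕ →. ℕ) := by
    have hu2 := Primrec.unpair.comp (Primrec.snd.comp Primrec.unpair)
    exact (RecursiveIn.of_prim htest).comp' (RecursiveIn.pair' 
      ((seg_rec S).comp' (RecursiveIn.of_prim (Primrec.fst.comp hu2))) 
      (RecursiveIn.of_prim (Primrec₂.natPair.comp (Primrec.fst.comp Primrec.unpair) 
        (Primrec.snd.comp hu2))))
  let out : ℕ → ℕ := fun m => if m.unpair.2 = 1 then 1 else 0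
  have hout : Primrec out := Primrec.ite (Primrec.eq.comp (Primrec.snd.comp Primrec.unpair) 
    (Primrec.const 1)) (Primrec.const 1) (Primrec.const 0)
  have h := (RecursiveIn.of_prim (O := chi S) hout).comp (RecursiveIn.rfind hbody)
  unfold TuringLE
  refine h.of_eq fun p => ?_
  simp only [PFun.coe_val, Nat.unpair_pair]
  rw [Part.eq_some_iff]
  refine Part.mem_bind_iff.2 ?_
  have key : ∀ m : ℕ, test (Nat.pair (Encodable.encode (seg (bits S) m.unpair.1)) 
      (Nat.pair p m.unpair.2)) = 0 ↔ D (seg (bits S) m.unpair.1) (p, decide (m.unpair.2 = 1)) := by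
    intro m
    simp [test]
  obtain ⟨n, hn⟩ := (hP (p, bits W p)).1 rfl
  have hex := Nat.rfind_min' (p := fun m => decide (test (Nat.pair 
    (Encodable.encode (seg (bits S) m.unpair.1)) (Nat.pair p m.unpair.2)) = 0)) 
    (m := Nat.pair n (cond (bits W p) 1 0)) (by
      simp only [decide_eq_true_eq]
      rw [key]
      cases hb : bits W p <;> simpa [hb] using hn)
  obtain ⟨m, hm, -⟩ := hex
  refine ⟨m, ?_, ?_⟩
  · convert hm using 1
    refine congrArg Nat.rfind (funext fun n => ?_)
    simp
  · have h1 := Nat.rfind_spec hm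
    have h2 : test (Nat.pair (Encodable.encode (seg (bits S) m.unpair.1)) 
      (Nat.pair p m.unpair.2)) = 0 := by simpa using h1
    rw [key] at h2
    have h3 : bits W p = decide (m.unpair.2 = 1) := (hP (p, _)).2 ⟨_, h2⟩
    by_cases hx : p ∈ W <;> by_cases hm' : m.unpair.2 = 1 <;> 
      simp [bits, hx, hm', out, chi] at h3 ⊢

end RRT
namespace RRT

/-- join of Boolean oracles. -/
def bjoin (R Y : ℕ → Bool) : ℕ → Bool := fun i => if i % 2 = 0 then R (i / 2) else Y (i / 2)

theorem bits_join (Z Y : Set ℕ) : bits (join Z Y) = bjoin (bits Z) (bits Y) := by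
  funext i
  have h : i ∈ join Z Y ↔ (if i % 2 = 0 then i / 2 ∈ Z else i / 2 ∈ Y) := by
    unfold join
    constructor
    · rintro (⟨m, hm, rfl⟩ | ⟨m, hm, rfl⟩)
      · simpa using hm
      · have h1 : (2 * m + 1) % 2 = 1 := by omega
        have h2 : (2 * m + 1) / 2 = m := by omega
        simpa [h1, h2] using hm
    · intro h
      split_ifs at h with hi
      · exact Or.inl ⟨_, h, by omega⟩
      · exact Or.inr ⟨_, h, by omega⟩
  unfold bjoin bits
  split_ifs with hi <;> simp [h, hi]

section
variable {β : Type} [Primcodable β] {R B : ℕ → Bool}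

/-- partial join relation -/
def JR (R : ℕ → Bool) (Q : ℕ → Bool → Prop) (i : ℕ) (b : Bool) : Prop :=
  (i % 2 = 0 ∧ R (i / 2) = b) ∨ (i % 2 = 1 ∧ Q (i / 2) b)

theorem JR_total (R Y : ℕ → Bool) : JR R (fun i b => Y i = b) = fun i b => bjoin R Y i = b := by
  funext i b
  unfold JR bjoin
  rcases Nat.mod_two_eq_zero_or_one i with h | h <;> simp [h]

theorem CE.JR (hR : CE B (fun x : ℕ × Bool => R x.1 = x.2)) {Q : β → ℕ → Bool → Prop}
    (hQ : CE B (fun x : β × ℕ × Bool => Q x.1 x.2.1 x.2.2)) :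
    CE B (fun x : β × ℕ × Bool => JR R (Q x.1) x.2.1 x.2.2) := by
  have hi : Primrec (fun x : β × ℕ × Bool => x.2.1) := Primrec.fst.comp Primrec.snd
  have hb : Primrec (fun x : β × ℕ × Bool => x.2.2) := Primrec.snd.comp Primrec.snd
  have hd : Primrec (fun x : β × ℕ × Bool => x.2.1 / 2) := Primrec.nat_div.comp hi (Primrec.const 2)
  have hm : Primrec (fun x : β × ℕ × Bool => x.2.1 % 2) := Primrec.nat_mod.comp hi (Primrec.const 2)
  refine CE.or (CE.and (CE.prim ?_) ?_) (CE.and (CE.prim ?_) ?_)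
  · exact Primrec.eq.comp hm (Primrec.const 0)
  · exact hR.comp (f := fun x : β × ℕ × Bool => (x.2.1 / 2, x.2.2)) (Primrec.pair hd hb)
  · exact Primrec.eq.comp hm (Primrec.const 1)
  · exact hQ.comp (f := fun x : β × ℕ × Bool => (x.1, x.2.1 / 2, x.2.2))
      (Primrec.pair Primrec.fst (Primrec.pair hd hb))

theorem CE.bjoin {Y : ℕ → Bool} (hR : CE B (fun x : ℕ × Bool => R x.1 = x.2))
    (hY : CE B (fun x : ℕ × Bool => Y x.1 = x.2)) :
    CE B (fun x : ℕ × Bool => bjoin R Y x.1 = x.2) := by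
  have := CE.JR (β := Unit) hR (Q := fun _ i b => Y i = b) (hY.comp Primrec.snd)
  refine (this.comp (f := fun x : ℕ × Bool => ((), x)) 
    (Primrec.pair (Primrec.const _) Primrec.id)).of_iff fun x => ?_
  rw [JR_total]

theorem CE.left (R Y : ℕ → Bool) : CE (RRT.bjoin R Y) (fun x : ℕ × Bool => R x.1 = x.2) := by
  refine (CE.oracle.comp (f := fun x : ℕ × Bool => (2 * x.1, x.2)) (Primrec.pair 
    (Primrec.nat_mul.comp (Primrec.const 2) Primrec.fst) Primrec.snd)).of_iff fun x => ?_
  simp [RRT.bjoin]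

theorem CE.right (R Y : ℕ → Bool) : CE (RRT.bjoin R Y) (fun x : ℕ × Bool => Y x.1 = x.2) := by
  refine (CE.oracle.comp (f := fun x : ℕ × Bool => (2 * x.1 + 1, x.2)) (Primrec.pair 
    (Primrec.succ.comp (Primrec.nat_mul.comp (Primrec.const 2) Primrec.fst)) 
    Primrec.snd)).of_iff fun x => ?_
  have h1 : (2 * x.1 + 1) % 2 = 1 := by omega
  have h2 : (2 * x.1 + 1) / 2 = x.1 := by omega
  simp [RRT.bjoin, h1, h2]

/-- reduction of `Z ⊕ X'` to `B` when `X' = X ∧ T` with both decidable. -/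
theorem CE.band {X Y : ℕ → Bool} (hX : CE B (fun x : ℕ × Bool => X x.1 = x.2))
    (hY : CE B (fun x : ℕ × Bool => Y x.1 = x.2)) :
    CE B (fun x : ℕ × Bool => (X x.1 && Y x.1) = x.2) := by
  have hc : ∀ b : Bool, Primrec (fun x : ℕ × Bool => (x.1, b)) := fun b => 
    Primrec.pair Primrec.fst (Primrec.const b)
  have hs : ∀ b : Bool, PrimrecPred (fun x : ℕ × Bool => x.2 = b) := fun b => 
    Primrec.eq.comp Primrec.snd (Primrec.const b)
  refine (((CE.prim (hs true)).and ((hX.comp (hc true)).and (hY.comp (hc true)))).or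
    ((CE.prim (hs false)).and ((hX.comp (hc false)).or (hY.comp (hc false))))).of_iff fun x => ?_
  obtain ⟨x, b⟩ := x
  cases b <;> cases X x <;> cases Y x <;> simp

end

theorem enum_ops (α : Type) [Primcodable α] : ∃ D : ℕ → List Bool → α → Prop, (∀ e, PrimrecRel (D e)) ∧
    ∀ D', PrimrecRel D' → ∃ e, D e = D' := by
  have hcount : Set.Countable {D : List Bool → α → Prop | PrimrecRel D} := by
    classical
    let F : {D : List Bool → α → Prop // PrimrecRel D} → {f : ℕ → ℕ // Computable f} := fun D =>
      ⟨fun n => Encodable.encode ((Encodable.decode n : Option (List Bool × α)).map 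
        (fun p => decide (D.1 p.1 p.2))), by
        apply Primrec.to_comp
        exact Primrec.encode.comp (Primrec.option_map Primrec.decode 
          ((PrimrecPred.decide D.2).comp Primrec.snd))⟩
    have hF : Function.Injective F := by
      intro D D' h
      apply Subtype.ext
      funext ρ a
      have := congrFun (congrArg Subtype.val h) (Encodable.encode (ρ, a))
      simp only [F, Encodable.encodek, Option.map_some] at this
      have := Encodable.encode_injective this
      simpa using this
    exact hF.countable
  have hne : {D : List Bool → α → Prop | PrimrecRel D}.Nonempty :=
    ⟨fun _ _ => True, (PrimrecPred.of_eq (Primrec.eq.comp (Primrec.const 0) (Primrec.const 0)) 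
      (fun _ => by simp) : PrimrecPred fun p : List Bool × α => True)⟩
  obtain ⟨D, hD⟩ := hcount.exists_eq_range hne
  refine ⟨D, fun e => ?_, fun D' h => ?_⟩
  · have : D e ∈ {D : List Bool → α → Prop | PrimrecRel D} := hD ▸ ⟨e, rfl⟩
    exact this
  · have : D' ∈ Set.range D := hD ▸ h
    exact this

section
variable {α : Type} [Primcodable α] {G : α → Prop}

theorem seg_rel_mono (Y : ℕ → Bool) (n i : ℕ) (b : Bool) (h : (seg Y n)[i]? = some b) : 
    Y i = b := by
  rw [seg_getElem?] at h
  split_ifs at h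
  simpa using h

/-- evaluation with partial information on the right half. -/
theorem evR_seg (D : List Bool → α → Prop) (R Y : ℕ → Bool) (q : α) :
    (∃ n, EvR D (JR R (fun i b => (seg Y n)[i]? = some b)) q) ↔ Ev D (bjoin R Y) q := by
  rw [← evR_iff, ← JR_total]
  constructor
  · rintro ⟨n, ρ, h, h'⟩
    refine ⟨ρ, h, fun i hi => ?_⟩
    rcases h' i hi with h1 | ⟨h1, h2⟩
    · exact Or.inl h1
    · exact Or.inr ⟨h1, seg_rel_mono _ _ _ _ h2⟩
  · rintro ⟨ρ, h, h'⟩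
    refine ⟨ρ.length, ρ, h, fun i hi => ?_⟩
    rcases h' i hi with h1 | ⟨h1, h2⟩
    · exact Or.inl h1
    · refine Or.inr ⟨h1, ?_⟩
      show (seg Y ρ.length)[i / 2]? = _
      rw [seg_getElem?, if_pos (by omega), h2]

theorem CE.seg_rel {B : ℕ → Bool} : 
    CE B (fun x : List Bool × ℕ × Bool => x.1[x.2.1]? = some x.2.2) :=
  CE.prim (Primrec.eq.comp (Primrec.list_getElem?.comp Primrec.fst (Primrec.fst.comp Primrec.snd))
    (Primrec.option_some.comp (Primrec.snd.comp Primrec.snd)))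

theorem basis_step {R : ℕ → Bool} (hR : ¬ CE R G) {D : List Bool → α → Prop} (hD : PrimrecRel D)
    (C : List Bool → Prop) (hC : CE R C) (hne : ∃ Y, ∀ n, ¬ C (seg Y n)) :
    ∃ C' : List Bool → Prop, (∀ l, C l → C' l) ∧ CE R C' ∧ (∃ Y, ∀ n, ¬ C' (seg Y n)) ∧
      ∀ Y, (∀ n, ¬ C' (seg Y n)) → ¬ ∀ q, G q ↔ Ev D (bjoin R Y) q := by
  let V : List Bool × α → Prop := fun x => C x.1 ∨ 
    EvR D (JR R (fun i b => x.1[i]? = some b)) x.2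
  have hV : CE R V := (hC.comp Primrec.fst).or 
    (CE.evR hD (Q := fun l => JR R (fun i b => l[i]? = some b)) 
      (CE.JR (Q := fun (l : List Bool) i b => l[i]? = some b) CE.oracle CE.seg_rel))
  by_cases h : ∃ q, (∀ Y, ∃ n, V (seg Y n, q)) ∧ ¬ G q
  · obtain ⟨q, h1, h2⟩ := h
    refine ⟨C, fun _ h => h, hC, hne, fun Y hY H => h2 ((H q).2 ?_)⟩
    obtain ⟨n, hn | hn⟩ := h1 Y
    · exact absurd hn (hY n)
    · exact (evR_seg D R Y q).1 ⟨n, hn⟩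
  by_cases h' : ∃ q, G q ∧ ¬ (∀ Y, ∃ n, V (seg Y n, q))
  · obtain ⟨q, h1, h2⟩ := h'
    push Not at h2
    refine ⟨fun l => V (l, q), fun l hl => Or.inl hl, 
      hV.comp (Primrec.pair Primrec.id (Primrec.const q)), h2, fun Y hY H => ?_⟩
    obtain ⟨n, hn⟩ := (evR_seg D R Y q).2 ((H q).1 h1)
    exact hY n (Or.inr hn)
  · exfalso
    refine hR (hV.compact.of_iff fun q => ⟨fun hq => ?_, fun hq => ?_⟩)
    · by_contra hc; exact h' ⟨q, hq, hc⟩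
    · by_contra hc; exact h ⟨q, hq, hc⟩

/-- Cone avoidance basis theorem. -/
theorem basis {R : ℕ → Bool} (hR : ¬ CE R G)
    (C : List Bool → Prop) (hC : CE R C) (hne : ∃ Y, ∀ n, ¬ C (seg Y n)) :
    ∃ Y, (∀ n, ¬ C (seg Y n)) ∧ ¬ CE (bjoin R Y) G := by
  obtain ⟨D, hD, hsurj⟩ := enum_ops α
  let T := {C : List Bool → Prop // CE R C ∧ ∃ Y, ∀ n, ¬ C (seg Y n)}
  have step : ∀ (e : ℕ) (C : T), ∃ C' : T, (∀ l, C.1 l → C'.1 l) ∧ 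
      ∀ Y, (∀ n, ¬ C'.1 (seg Y n)) → ¬ ∀ q, G q ↔ Ev (D e) (bjoin R Y) q := by
    rintro e ⟨C, h1, h2⟩
    obtain ⟨C', a, b, c, d⟩ := basis_step hR (hD e) C h1 h2
    exact ⟨⟨C', b, c⟩, a, d⟩
  choose nx h1 h2 using step
  let s : ℕ → T := fun n => Nat.rec ⟨C, hC, hne⟩ (fun e C => nx e C) n
  have hs : ∀ e, s (e+1) = nx e (s e) := fun e => rfl
  have hmono : ∀ m n, m ≤ n → ∀ l, (s m).1 l → (s n).1 l := by
    intro m n hmn l h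
    induction hmn with
    | refl => exact h
    | step _ ih => exact h1 _ _ _ ih
  -- compactness
  have hex : ∃ Y, ∀ n e, ¬ (s e).1 (seg Y n) := by
    by_contra hc
    push Not at hc
    obtain ⟨N, hN⟩ := koenig (fun l => ∃ m ≤ l.length, ∃ e ≤ l.length, (s e).1 (l.take m)) (by
      intro Y
      obtain ⟨n, e, h⟩ := hc Y
      refine ⟨max n e, n, by simp [seg_length], e, by simp [seg_length], ?_⟩
      rw [seg_take, min_eq_left (le_max_left _ _)]
      exact h)
    obtain ⟨Y, hY⟩ := (s N).2.2
    obtain ⟨k, hk, m, hm, e, he, h⟩ := hN Y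
    rw [seg_length] at he
    rw [seg_take] at h
    exact hY _ (hmono e N (by omega) _ h)
  obtain ⟨Y, hY⟩ := hex
  refine ⟨Y, fun n => hY n 0, ?_⟩
  rintro ⟨D', hD', hP⟩
  obtain ⟨e, rfl⟩ := hsurj D' hD'
  exact h2 e (s e) Y (fun n => hY n (e+1)) hP

end
end RRT
namespace RRT

theorem seg_bjoin_congr (Z Y Y' : ℕ → Bool) (n : ℕ) (h : ∀ j < n, Y j = Y' j) :
    seg (bjoin Z Y) n = seg (bjoin Z Y') n := by
  unfold seg bjoin
  apply List.map_congr_left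
  intro i hi
  have := List.mem_range.1 hi
  rw [h (i / 2) (by omega)]

section forcing
variable {α : Type} [Primcodable α]

theorem nce_sub {G : α → Prop} {B Z X T : ℕ → Bool} (hZ : CE B (fun x : ℕ × Bool => Z x.1 = x.2))
    (hX : CE B (fun x : ℕ × Bool => X x.1 = x.2)) (hT : CE B (fun x : ℕ × Bool => T x.1 = x.2))
    (h : ¬ CE B G) : ¬ CE (bjoin Z (fun i => X i && T i)) G :=
  fun h' => h (CE.trans (CE.bjoin hZ (CE.band hX hT)) h')

theorem nce_trunc {G : α → Prop} {Z X : ℕ → Bool} (n : ℕ) (h : ¬ CE (bjoin Z X) G) :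
    ¬ CE (bjoin Z (fun i => X i && decide (n < i))) G := by
  refine nce_sub (CE.left _ _) (CE.right _ _) (CE.prim ?_) h
  exact Primrec.eq.comp ((Primrec.nat_lt.comp (Primrec.const n) Primrec.fst).decide) Primrec.snd

/-- Forcing conditions. -/
structure Cond (G : α → Prop) (Z A X0 : ℕ → Bool) where
  F : Bool → Finset ℕ
  X : ℕ → Bool
  inf : ∀ n, ∃ m, n < m ∧ X m = true
  nce : ¬ CE (bjoin Z X) G
  sub : ∀ i, X i = true → X0 i = true
  FA : ∀ b, ∀ i ∈ F b, A i = b ∧ X0 i = true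
  lt : ∀ b, ∀ i ∈ F b, ∀ x, X x = true → i < x

variable {G : α → Prop} {Z A X0 : ℕ → Bool}

structure Cond.Ext (c' c : Cond G Z A X0) : Prop where
  F1 : ∀ b, c.F b ⊆ c'.F b
  F2 : ∀ b, ∀ i ∈ c'.F b, i ∈ c.F b ∨ c.X i = true
  X1 : ∀ i, c'.X i = true → c.X i = true

theorem Cond.Ext.refl (c : Cond G Z A X0) : c.Ext c := ⟨fun _ => subset_rfl, fun _ _ h => Or.inl h,
  fun _ h => h⟩

theorem Cond.Ext.trans {a b c : Cond G Z A X0} (h : a.Ext b) (h' : b.Ext c) : a.Ext c := by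
  refine ⟨fun s => (h'.F1 s).trans (h.F1 s), fun s i hi => ?_, fun i hi => h'.X1 i (h.X1 i hi)⟩
  rcases h.F2 s i hi with h1 | h1
  · exact h'.F2 s i h1
  · exact Or.inr (h'.X1 i h1)

def Cond.Forces (c : Cond G Z A X0) (b : Bool) (D : List Bool → α → Prop) : Prop :=
  ∀ Y : ℕ → Bool, (∀ i ∈ c.F b, Y i = true) → (∀ i, Y i = true → i ∈ c.F b ∨ c.X i = true) →
    ¬ ∀ q, G q ↔ Ev D (bjoin Z Y) q

/-- extend one side by a finite set, truncating the reservoir -/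
theorem Cond.extend (c : Cond G Z A X0) (b : Bool) (E : Finset ℕ) (N : ℕ)
    (hE : ∀ i ∈ E, c.X i = true ∧ A i = b ∧ i ≤ N) :
    ∃ c' : Cond G Z A X0, c'.Ext c ∧ c'.F b = c.F b ∪ E ∧ ∀ i, c'.X i = true → N < i := by
  refine ⟨⟨fun s => if s = b then c.F s ∪ E else c.F s, fun i => c.X i && decide (N < i), ?_, 
    nce_trunc N c.nce, ?_, ?_, ?_⟩, ⟨?_, ?_, ?_⟩, ?_, ?_⟩
  · intro n
    obtain ⟨m, hm, h⟩ := c.inf (max n N)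
    exact ⟨m, (le_max_left _ _).trans_lt hm, by simp [h, (le_max_right n N).trans_lt hm]⟩
  · intro i hi
    simp only [Bool.and_eq_true, decide_eq_true_eq] at hi
    exact c.sub i hi.1
  · intro s i hi
    split_ifs at hi with hs
    · subst hs
      rcases Finset.mem_union.1 hi with h | h
      · exact c.FA _ i h
      · exact ⟨(hE i h).2.1, c.sub i (hE i h).1⟩
    · exact c.FA _ i hi
  · intro s i hi x hx
    simp only [Bool.and_eq_true, decide_eq_true_eq] at hx
    split_ifs at hi with hs
    · rcases Finset.mem_union.1 hi with h | h
      · exact c.lt _ i h x hx.1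
      · exact (hE i h).2.2.trans_lt hx.2
    · exact c.lt _ i hi x hx.1
  · intro s
    dsimp only
    split_ifs
    · exact Finset.subset_union_left
    · exact subset_rfl
  · intro s i hi
    dsimp only at hi
    split_ifs at hi
    · rcases Finset.mem_union.1 hi with h | h
      · exact Or.inl h
      · exact Or.inr (hE i h).1
    · exact Or.inl hi
  · intro i hi
    simp only [Bool.and_eq_true, decide_eq_true_eq] at hi
    exact hi.1
  · simp
  · intro i hi
    simp only [Bool.and_eq_true, decide_eq_true_eq] at hi
    exact hi.2

/-- the oracle `F ∪ l` -/
def fl (F : Finset ℕ) (l : List ℕ) : ℕ → Bool := fun i => decide (i ∈ F ∨ i ∈ l)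

def Vb (Z X : ℕ → Bool) (F : Finset ℕ) (b : Bool) (D : List Bool → α → Prop) 
    (x : List Bool × α) : Prop :=
  ∃ l : List ℕ, (∀ i ∈ l, X i = true ∧ x.1[i]? = some b) ∧ 
    EvR D (JR Z (fun i c => fl F l i = c)) x.2

theorem mem_list_prim {β γ : Type} [Primcodable β] [Primcodable γ] [DecidableEq γ] {f : β → γ} {g : β → List γ} 
    (hf : Primrec f) (hg : Primrec g) : PrimrecPred (fun x => f x ∈ g x) :=
  (PrimrecRel.exists_mem_list (R := fun a b : γ => a = b) Primrec.eq |>.comp hg hf).of_eq 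
    fun x => by simp

theorem CE_Vb (Z X : ℕ → Bool) (F : Finset ℕ) (b : Bool) {D : List Bool → α → Prop} 
    (hD : PrimrecRel D) : CE (bjoin Z X) (Vb Z X F b D) := by
  refine CE.ex (P := fun y : (List Bool × α) × List ℕ => 
    (∀ i ∈ y.2, X i = true ∧ y.1.1[i]? = some b) ∧ 
    EvR D (JR Z (fun i c => fl F y.2 i = c)) y.1.2) (CE.and ?_ ?_)
  · refine CE.all (P := fun z : ((List Bool × α) × List ℕ) × ℕ => 
      X z.2 = true ∧ z.1.1.1[z.2]? = some b) (CE.and ?_ (CE.prim ?_)) Primrec.snd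
    · exact (CE.right Z X).comp (f := fun z : ((List Bool × α) × List ℕ) × ℕ => (z.2, true))
        (Primrec.pair Primrec.snd (Primrec.const _))
    · exact Primrec.eq.comp (Primrec.list_getElem?.comp 
        (Primrec.fst.comp (Primrec.fst.comp Primrec.fst)) Primrec.snd) (Primrec.const _)
  · have hQ : CE (bjoin Z X) (fun x : List ℕ × ℕ × Bool => fl F x.1 x.2.1 = x.2.2) := by
      refine CE.prim (Primrec.eq.comp (PrimrecPred.decide (PrimrecPred.or ?_ ?_)) 
        (Primrec.snd.comp Primrec.snd))
      · exact (mem_list_prim (g := fun _ => F.toList) (Primrec.fst.comp Primrec.snd) 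
          (Primrec.const _)).of_eq fun x => by simp
      · exact mem_list_prim (Primrec.fst.comp Primrec.snd) Primrec.fst
    have := CE.evR hD (Q := fun (l : List ℕ) => JR Z (fun i c => fl F l i = c))
      (CE.JR (Q := fun (l : List ℕ) i c => fl F l i = c) (CE.left Z X) hQ)
    exact this.comp (f := fun y : (List Bool × α) × List ℕ => (y.2, y.1.2))
      (Primrec.pair Primrec.snd (Primrec.snd.comp Primrec.fst))

theorem Cond.step (c : Cond G Z A X0) (D : Bool → List Bool → α → Prop) 
    (hD : ∀ b, PrimrecRel (D b)) : ∃ c' : Cond G Z A X0, c'.Ext c ∧ ∃ b, c'.Forces b (D b) := by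
  let V : List Bool × α → Prop := fun x => Vb Z c.X (c.F true) true (D true) x ∨ 
    Vb Z c.X (c.F false) false (D false) x
  have hV : CE (bjoin Z c.X) V := (CE_Vb _ _ _ _ (hD _)).or (CE_Vb _ _ _ _ (hD _))
  have hVb : ∀ x, V x ↔ ∃ b, Vb Z c.X (c.F b) b (D b) x := by
    intro x; simp [V, or_comm]
  by_cases h : ∃ q, (∀ Y, ∃ n, V (seg Y n, q)) ∧ ¬ G q
  · obtain ⟨q, h1, h2⟩ := h
    obtain ⟨n, hn⟩ := h1 A
    obtain ⟨b, l, hl, hev⟩ := (hVb _).1 hn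
    rw [JR_total, evR_iff] at hev
    obtain ⟨k, hk⟩ := hev
    obtain ⟨c', hc, hF, hX⟩ := c.extend b l.toFinset (k + l.toFinset.sup id) (by
      intro i hi
      have h3 := hl i (List.mem_toFinset.1 hi)
      refine ⟨h3.1, seg_rel_mono _ _ _ _ h3.2, ?_⟩
      have := Finset.le_sup (f := id) hi
      simp only [id] at this
      omega)
    refine ⟨c', hc, b, fun Y hY1 hY2 H => h2 ((H q).2 ⟨k, ?_⟩)⟩
    rw [seg_bjoin_congr Z Y (fl (c.F b) l)]
    · exact hk
    · intro j hj
      rw [Bool.eq_iff_iff]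
      constructor
      · intro hYj
        rcases hY2 j hYj with h4 | h4
        · rw [hF] at h4
          simpa [fl] using h4
        · have := hX j h4
          omega
      · intro h4
        apply hY1
        rw [hF]
        simpa [fl] using h4
  by_cases h' : ∃ q, G q ∧ ¬ (∀ Y, ∃ n, V (seg Y n, q))
  · obtain ⟨q, h1, h2⟩ := h'
    push Not at h2
    obtain ⟨Y, hY, hnce⟩ := basis c.nce (fun l => V (l, q))
      (hV.comp (Primrec.pair Primrec.id (Primrec.const q))) h2
    have hinf : ∃ b, ∀ n, ∃ m, n < m ∧ (c.X m && (Y m == b)) = true := by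
      by_contra hc
      push Not at hc
      obtain ⟨n1, hn1⟩ := hc true
      obtain ⟨n2, hn2⟩ := hc false
      obtain ⟨m, hm, hX⟩ := c.inf (max n1 n2)
      have e1 := hn1 m ((le_max_left _ _).trans_lt hm)
      have e2 := hn2 m ((le_max_right _ _).trans_lt hm)
      cases hYm : Y m <;> simp [hX, hYm] at e1 e2
    obtain ⟨b, hb⟩ := hinf
    have hT : CE (bjoin (bjoin Z c.X) Y) (fun x : ℕ × Bool => (Y x.1 == b) = x.2) := by
      refine ((CE.right (bjoin Z c.X) Y).comp (f := fun x : ℕ × Bool => (x.1, x.2 == b)) 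
        (Primrec.pair Primrec.fst (Primrec.beq.comp Primrec.snd (Primrec.const b)))).of_iff ?_
      rintro ⟨x, s⟩
      cases b <;> cases s <;> cases hYx : Y x <;> simp [hYx]
    let c' : Cond G Z A X0 := ⟨c.F, fun i => c.X i && (Y i == b), hb, 
      nce_sub (CE.trans (CE.left _ _) (CE.left Z c.X)) (CE.trans (CE.left _ _) (CE.right Z c.X)) 
        hT hnce, fun i hi => c.sub i (by simp at hi; exact hi.1), c.FA, 
        fun s i hi x hx => c.lt s i hi x (by simp at hx; exact hx.1)⟩
    refine ⟨c', ⟨fun _ => subset_rfl, fun _ _ h => Or.inl h, 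
      fun i hi => by simp [c'] at hi; exact hi.1⟩, b, fun Y' hY1 hY2 H => ?_⟩
    obtain ⟨n, hn⟩ := (H q).1 h1
    refine hY n ((hVb _).2 ⟨b, (List.range n).filter (fun i => c'.X i && Y' i), ?_, ?_⟩)
    · intro i hi
      simp only [List.mem_filter, List.mem_range, c', Bool.and_eq_true, beq_iff_eq] at hi
      refine ⟨hi.2.1.1, ?_⟩
      rw [seg_getElem?, if_pos hi.1, hi.2.1.2]
    · rw [JR_total, evR_iff]
      refine ⟨n, ?_⟩
      rw [seg_bjoin_congr Z _ Y']
      · exact hn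
      · intro j hj
        rw [Bool.eq_iff_iff]
        simp only [fl, decide_eq_true_eq, List.mem_filter, List.mem_range, Bool.and_eq_true]
        constructor
        · rintro (h4 | h4)
          · exact hY1 j h4
          · exact h4.2.2
        · intro h4
          rcases hY2 j h4 with h5 | h5
          · exact Or.inl h5
          · exact Or.inr ⟨hj, h5, h4⟩
  · exfalso
    refine c.nce (hV.compact.of_iff fun q => ⟨fun hq => ?_, fun hq => ?_⟩)
    · by_contra hc; exact h' ⟨q, hq, hc⟩
    · by_contra hc; exact h ⟨q, hq, hc⟩

/-- Strong cone avoidance for the pigeonhole principle. -/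
theorem strong_avoid (G : α → Prop) (Z A X0 : ℕ → Bool) (hinf : ∀ n, ∃ m, n < m ∧ X0 m = true)
    (hnce : ¬ CE (bjoin Z X0) G) :
    ∃ b, ∃ Y : ℕ → Bool, (∀ n, ∃ m, n < m ∧ Y m = true) ∧ 
      (∀ i, Y i = true → X0 i = true ∧ A i = b) ∧ ¬ CE (bjoin Z Y) G := by
  by_contra hno
  push Not at hno
  obtain ⟨D, hD, hsurj⟩ := enum_ops α
  let c0 : Cond G Z A X0 := ⟨fun _ => ∅, X0, hinf, hnce, fun _ h => h, by simp, by simp⟩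
  have hdense : ∃ b, ∃ c1 : Cond G Z A X0, ∀ c, c.Ext c1 → ∀ e, ∃ c' : Cond G Z A X0, 
      c'.Ext c ∧ c'.Forces b (D e) := by
    by_contra hc
    push Not at hc
    obtain ⟨c1, h1, e1, hf1⟩ := hc true c0
    obtain ⟨c2, h2, e2, hf2⟩ := hc false c1
    obtain ⟨c3, h3, b, hb⟩ := c2.step (fun b => D (cond b e1 e2)) (fun b => hD _)
    cases b
    · exact hf2 c3 h3 hb
    · exact hf1 c3 (h3.trans h2) hb
  obtain ⟨b, c1, hc1⟩ := hdense
  have henl : ∀ (c : Cond G Z A X0) (N : ℕ), ∃ c' : Cond G Z A X0, c'.Ext c ∧ 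
      ∃ i ∈ c'.F b, N < i := by
    intro c N
    have : ∃ m, N < m ∧ c.X m = true ∧ A m = b := by
      by_contra hc
      push Not at hc
      refine nce_trunc N c.nce (hno (!b) _ ?_ ?_)
      · intro n
        obtain ⟨m, hm, h⟩ := c.inf (max n N)
        exact ⟨m, (le_max_left _ _).trans_lt hm, by simp [h, (le_max_right n N).trans_lt hm]⟩
      · intro i hi
        simp only [Bool.and_eq_true, decide_eq_true_eq] at hi
        refine ⟨c.sub i hi.1, ?_⟩
        have := hc i hi.2 hi.1
        cases b <;> simpa using this
    obtain ⟨m, hm, hX, hA⟩ := this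
    obtain ⟨c', h1, h2, h3⟩ := c.extend b {m} m (by simp [hX, hA])
    exact ⟨c', h1, m, by simp [h2], hm⟩
  let T := {c : Cond G Z A X0 // c.Ext c1}
  have hstep : ∀ (e : ℕ) (c : T), ∃ c' : T, c'.1.Ext c.1 ∧ c'.1.Forces b (D e) ∧ 
      ∃ i ∈ c'.1.F b, e < i := by
    rintro e ⟨c, hc⟩
    obtain ⟨c', h1, h2⟩ := henl c e
    obtain ⟨c'', h3, h4⟩ := hc1 c' (h1.trans hc) e
    obtain ⟨i, hi, hi'⟩ := h2
    exact ⟨⟨c'', h3.trans (h1.trans hc)⟩, h3.trans h1, h4, i, h3.F1 b hi, hi'⟩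
  choose nx hx1 hx2 hx3 using hstep
  let s : ℕ → T := fun n => Nat.rec ⟨c1, Cond.Ext.refl _⟩ (fun e c => nx e c) n
  have hmono : ∀ m n, m ≤ n → (s n).1.Ext (s m).1 := by
    intro m n hmn
    induction hmn with
    | refl => exact Cond.Ext.refl _
    | step _ ih => exact (hx1 _ _).trans ih
  classical
  let Y : ℕ → Bool := fun i => decide (∃ n, i ∈ (s n).1.F b)
  have hY : ∀ i, Y i = true ↔ ∃ n, i ∈ (s n).1.F b := fun i => by simp [Y]
  refine absurd (hno b Y ?_ ?_) ?_
  · intro n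
    obtain ⟨i, hi, hi'⟩ := hx3 n (s n)
    exact ⟨i, hi', (hY i).2 ⟨n + 1, hi⟩⟩
  · intro i hi
    obtain ⟨n, hn⟩ := (hY i).1 hi
    exact ⟨((s n).1.FA b i hn).2, ((s n).1.FA b i hn).1⟩
  · rintro ⟨D', hD', hP⟩
    obtain ⟨e, rfl⟩ := hsurj D' hD'
    refine hx2 e (s e) Y (fun i hi => (hY i).2 ⟨e + 1, hi⟩) (fun i hi => ?_) hP
    obtain ⟨n, hn⟩ := (hY i).1 hi
    rcases le_total n (e + 1) with h | h
    · exact Or.inl ((hmono n (e+1) h).F1 b hn)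
    · exact (hmono (e+1) n h).F2 b i hn

end forcing

/-- Set version. -/
theorem strong_avoid_set (W Z X A : Set ℕ) (hinf : X.Infinite) (h : ¬ TuringLE W (join Z X)) :
    ∃ Y ⊆ X, Y.Infinite ∧ (Y ⊆ A ∨ Disjoint Y A) ∧ ¬ TuringLE W (join Z Y) := by
  classical
  have h1 : ¬ CE (bjoin (bits Z) (bits X)) (Gr W) := by
    rw [← bits_join]
    exact fun h' => h (turingLE_of_ce h')
  obtain ⟨b, Y, hY1, hY2, hY3⟩ := strong_avoid (Gr W) (bits Z) (bits A) (bits X) (by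
    intro n
    obtain ⟨m, hm, hm'⟩ := hinf.exists_gt n
    exact ⟨m, hm', by simpa [bits] using hm⟩) h1
  have hb : bits {i | Y i = true} = Y := by
    funext i; simp [bits]
  refine ⟨{i | Y i = true}, ?_, ?_, ?_, ?_⟩
  · intro i hi
    simpa [bits] using (hY2 i hi).1
  · refine Set.infinite_of_forall_exists_gt fun n => ?_
    obtain ⟨m, hm, hm'⟩ := hY1 n
    exact ⟨m, hm', hm⟩
  · cases b
    · right
      rw [Set.disjoint_left]
      intro i hi
      simpa [bits] using (hY2 i hi).2
    · left
      intro i hi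
      simpa [bits] using (hY2 i hi).2
  · intro h'
    have := ce_of_turingLE h'
    rw [bits_join, hb] at this
    exact hY3 this

end RRT
namespace RRT

/-- The inductive search through a list of candidates. -/
theorem candidate_search (W Z : Set ℕ) (A : ℕ → Set ℕ) (S : Finset ℕ) :
    ∀ X : Set ℕ, X.Infinite → ¬ TuringLE W (join Z X) →
    ∃ Y ⊆ X, Y.Infinite ∧ ¬ TuringLE W (join Z Y) ∧
      ((∃ x ∈ S, Disjoint Y (A x)) ∨ ∀ x ∈ S, Y ⊆ A x) := by
  induction S using Finset.induction_on with
  | empty =>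
    intro X hX hW
    exact ⟨X, subset_rfl, hX, hW, Or.inr (by simp)⟩
  | insert x S _ ih =>
    intro X hX hW
    obtain ⟨Y, hYX, hYi, hYd, hYW⟩ := strong_avoid_set W Z X (A x) hX hW
    rcases hYd with hYA | hYA
    · obtain ⟨Y', h1, h2, h3, h4⟩ := ih Y hYi hYW
      refine ⟨Y', h1.trans hYX, h2, h3, ?_⟩
      rcases h4 with ⟨z, hz, hd⟩ | h4
      · exact Or.inl ⟨z, Finset.mem_insert_of_mem hz, hd⟩
      · right
        intro z hz
        rcases Finset.mem_insert.1 hz with rfl | hz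
        · exact h1.trans hYA
        · exact h4 z hz
    · exact ⟨Y, hYX, hYi, hYW, Or.inl ⟨x, Finset.mem_insert_self _ _, hYA⟩⟩

/-- Two-boundedness with a common second coordinate. -/
theorem Bounded2Pairs.eq_of {f : ℕ → ℕ → ℕ} (h : Bounded2Pairs f) {a x x' y : ℕ}
    (hax : a < x) (hax' : a < x') (hx : x < y) (hx' : x' < y)
    (e : f a y = f x y) (e' : f a y = f x' y) : x = x' := by
  by_contra hne
  have hsub : (({(a, y), (x, y), (x', y)} : Finset (ℕ × ℕ)) : Set (ℕ × ℕ)) ⊆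
      {p : ℕ × ℕ | p.1 < p.2 ∧ f p.1 p.2 = f a y} := by
    intro p hp
    simp only [Finset.coe_insert, Finset.coe_singleton, Set.mem_insert_iff,
      Set.mem_singleton_iff] at hp
    rcases hp with rfl | rfl | rfl
    · exact ⟨hax.trans hx, rfl⟩
    · exact ⟨hx, e.symm⟩
    · exact ⟨hx', e'.symm⟩
  have h3 : ({(a, y), (x, y), (x', y)} : Finset (ℕ × ℕ)).card = 3 := by
    rw [Finset.card_eq_three]
    refine ⟨(a, y), (x, y), (x', y), ?_, ?_, ?_, rfl⟩ <;> simp <;> omega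
  have := (Set.encard_le_encard hsub).trans (h (f a y))
  rw [Set.encard_coe_eq_coe_finsetCard, h3] at this
  exact absurd this (by decide)

/-- Extending a rainbow by two points. -/
theorem rainbow_two {f : ℕ → ℕ → ℕ} (htail : TailRainbowOn f Set.univ) {σ : Finset ℕ}
    {x y : ℕ} (hx : x ∈ Vset f σ) (hy : y ∈ Vset f σ) (hxy : x < y)
    (hne : ∀ a ∈ σ, f a y ≠ f x y) : y ∈ Vset f (insert x σ) := by
  refine ⟨?_, ?_⟩
  · intro a ha
    rcases Finset.mem_insert.1 ha with rfl | ha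
    · exact hxy
    · exact hy.1 a ha
  · intro x₀ x₁ y₀ y₁ h1 h2 h3 h4 hl hm e
    have e1 : x₁ = y₁ := by
      by_contra hn
      exact htail x₀ x₁ y₀ y₁ trivial trivial trivial trivial hl hm hn e
    subst e1
    have hxσ := hx.1
    have hyσ := hy.1
    simp only [Finset.coe_insert, Set.mem_insert_iff, Finset.mem_coe] at h1 h2 h3
    have key : ∀ u, (u = y ∨ u = x ∨ u ∈ σ) → u < x₁ → x₁ ≠ y → (u = x ∨ u ∈ σ) := by
      intro u hu hlt hn
      rcases hu with rfl | hu
      · rcases h2 with rfl | rfl | h2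
        · omega
        · omega
        · have := hyσ _ h2; omega
      · exact hu
    by_cases hx1 : x₁ = y
    · subst hx1
      have g1 : x₀ = x ∨ x₀ ∈ σ := h1.resolve_left (by omega)
      have g3 : y₀ = x ∨ y₀ ∈ σ := h3.resolve_left (by omega)
      rcases g1 with rfl | g1
      · rcases g3 with rfl | g3
        · exact ⟨rfl, rfl⟩
        · exact absurd e.symm (hne _ g3)
      · rcases g3 with rfl | g3
        · exact absurd e (hne _ g1)
        · exact hy.2 x₀ x₁ y₀ x₁ (by simp [g1]) (by simp) (by simp [g3]) (by simp) hl hm e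
    · have g1 := key x₀ h1 hl hx1
      have g3 := key y₀ h3 hm hx1
      have g2 := h2.resolve_left hx1
      exact hx.2 x₀ x₁ y₀ x₁ (by simpa using g1) (by simpa using g2) (by simpa using g3)
        (by simpa using g2) hl hm e

/-- finite extension lemma: suppose `W ≰_T Z`, `f` is a 2-bounded coloring
of `[ℕ]²` with ℕ a tail `f`-rainbow, and `(σ, X)` is an admissible Mathias condition,
i.e. `X ⊆ V(σ, f)` and `W ≰_T Z ⊕ X`. Then there is an admissible Mathias condition
`(τ, Y) ≤_M (σ, X)` with `σ ⊊ τ`: `τ − σ ⊆ X`, `Y ⊆ X`, `max τ < min Y`, `Y ⊆ V(τ, f)`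
and `W ≰_T Z ⊕ Y`. -/
theorem statement9 (W Z : Set ℕ) (hWZ : ¬ TuringLE W Z) (f : ℕ → ℕ → ℕ)
    (hbounded : Bounded2Pairs f) (htail : TailRainbowOn f Set.univ)
    (σ : Finset ℕ) (X : Set ℕ) (hXinf : X.Infinite)
    (hcond : ∀ a ∈ σ, ∀ x ∈ X, a < x)
    (hadm₁ : X ⊆ Vset f σ) (hadm₂ : ¬ TuringLE W (join Z X)) :
    ∃ τ : Finset ℕ, ∃ Y : Set ℕ, σ ⊂ τ ∧ ↑(τ \ σ) ⊆ X ∧ Y ⊆ X ∧ Y.Infinite ∧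
      (∀ a ∈ τ, ∀ x ∈ Y, a < x) ∧ Y ⊆ Vset f τ ∧ ¬ TuringLE W (join Z Y) := by
  obtain ⟨S, hSX, hScard⟩ := hXinf.exists_subset_card_eq (σ.card + 1)
  obtain ⟨X', hX'X, hX'i, hX'd, hX'W⟩ :=
    strong_avoid_set W Z X {y | ∀ x ∈ S, x < y} hXinf hadm₂
  have habove : ∀ y ∈ X', ∀ x ∈ S, x < y := by
    rcases hX'd with h | h
    · exact fun y hy => h hy
    · exfalso
      apply hX'i
      apply (Set.finite_Iic (S.sup id)).subset
      intro y hy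
      by_contra hlt
      simp only [Set.mem_Iic, not_le] at hlt
      exact Set.disjoint_left.1 h hy
        (fun x hx => lt_of_le_of_lt (Finset.le_sup (f := id) hx) hlt)
  obtain ⟨Y, hYX', hYi, hYW, hY⟩ :=
    candidate_search W Z (fun x => {y | ∃ a ∈ σ, f a y = f x y}) S X' hX'i hX'W
  have hYX := hYX'.trans hX'X
  rcases hY with ⟨x, hxS, hd⟩ | hall
  · have hxX : x ∈ X := hSX hxS
    have hxσ : x ∉ σ := fun h => lt_irrefl _ (hcond x h x hxX)
    refine ⟨insert x σ, Y, Finset.ssubset_insert hxσ, ?_, hYX, hYi, ?_, ?_, hYW⟩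
    · intro z hz
      have hz' : z = x ∨ z ∈ σ := by
        have := (Finset.mem_sdiff.1 (Finset.mem_coe.1 hz)).1
        simpa using this
      have hz2 : z ∉ σ := (Finset.mem_sdiff.1 (Finset.mem_coe.1 hz)).2
      rcases hz' with rfl | h
      · exact hxX
      · exact absurd h hz2
    · intro a ha y hy
      rcases Finset.mem_insert.1 ha with rfl | ha
      · exact habove y (hYX' hy) _ hxS
      · exact hcond a ha y (hYX hy)
    · intro y hy
      exact rainbow_two htail (hadm₁ hxX) (hadm₁ (hYX hy)) (habove y (hYX' hy) x hxS)
        (fun a ha e => Set.disjoint_left.1 hd hy ⟨a, ha, e⟩)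
  · exfalso
    obtain ⟨y, hy⟩ := hYi.nonempty
    have hex : ∀ x : ℕ, ∃ a, x ∈ S → a ∈ σ ∧ f a y = f x y := by
      intro x
      by_cases hx : x ∈ S
      · obtain ⟨a, ha, e⟩ := hall x hx hy
        exact ⟨a, fun _ => ⟨ha, e⟩⟩
      · exact ⟨0, fun h => absurd h hx⟩
    choose g hg using hex
    obtain ⟨x, hx, x', hx', hne, heq⟩ :=
      Finset.exists_ne_map_eq_of_card_lt_of_maps_to (s := S) (t := σ) (f := g)
        (by omega) (fun x hx => (hg x hx).1)
    apply hne
    have e := (hg x hx).2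
    have e' := (hg x' hx').2
    rw [← heq] at e'
    exact hbounded.eq_of (hcond _ (hg x hx).1 x (hSX hx)) (hcond _ (hg x hx).1 x' (hSX hx'))
      (habove y (hYX' hy) x hx) (habove y (hYX' hy) x' hx') e e'

end RRT
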